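/- arXiv:2504.00836 — 3 statements merged into one kernel-verified Lean document; each statement's English description precedes it below -/
import Mathlib

section
/- Let b > 0. Then for all x, y ∈ ℝ, the gradient of the Rosenbrock-type function f(x,y) = x² + b(y − x²)², namely ∇f(x,y) = (2x − 4bx(y − x²), 2b(y − x²)), satisfies ⟨(x, y), ∇f(x,y)⟩ ≥ −(1/16)·‖∇f(x,y)‖². In other words, the global minimizer (0,0) of f is a (−1/16)-weak Minty solution of ∇f. -/
theorem statement17 (b : ℝ) (hb : 0 < b) (x y : ℝ) :
    x * (2 * x - 4 * b * x * (y - x ^ 2)) + y * (2 * b * (y - x ^ 2)) ≥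
      -(1 / 16) * ((2 * x - 4 * b * x * (y - x ^ 2)) ^ 2 + (2 * b * (y - x ^ 2)) ^ 2) := by
  have h : 0 ≤ (x * (2 * b * (y - x ^ 2) - 3)) ^ 2 / 4 + 2 * b * (y - x ^ 2) ^ 2
      + (2 * b * (y - x ^ 2)) ^ 2 / 16 := by positivity
  linarith
end

section
/- Let b > 0 and define f : ℝ³ → ℝ by f(x) = x₁x₂ + b(x₃ − x₁²)², with gradient ∇f(x) = (x₂ − 4bx₁(x₃ − x₁²), x₁, 2b(x₃ − x₁²)). Let X = {x ∈ ℝ³ : x₁ = x₂}, so that P_X is the matrix with rows (1/2, 1/2, 0), (1/2, 1/2, 0), (0, 0, 1) and P_{X⊥} the matrix with rows (1/2, −1/2, 0), (−1/2, 1/2, 0), (0, 0, 0). Then for all x ∈ ℝ³: ⟨x, ∇f(x)⟩ ≥ −(9/4)‖P_{X⊥} x‖² − (1/4)‖P_X ∇f(x)‖²; that is, ∇f is (−(9/4)·P_{X⊥}, −(1/4)·P_X)-semimonotone at the pair ((0,0,0), 0). -/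
theorem statement18 (b : ℝ) (hb : 0 < b) (x₁ x₂ x₃ : ℝ) :
    x₁ * (x₂ - 4 * b * x₁ * (x₃ - x₁ ^ 2)) + x₂ * x₁ + x₃ * (2 * b * (x₃ - x₁ ^ 2)) ≥
      -(9 / 4) * ((x₁ - x₂) ^ 2 / 2) -
      (1 / 4) * (((x₂ - 4 * b * x₁ * (x₃ - x₁ ^ 2)) + x₁) ^ 2 / 2 +
        (2 * b * (x₃ - x₁ ^ 2)) ^ 2) := by
  have gap : 0 ≤ 2 * b * (x₃ - x₁ ^ 2) ^ 2 + (5 / 4) * (x₂ - x₁ * (2 * b * (x₃ - x₁ ^ 2)) / 5) ^ 2 +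
      (9 / 20) * (x₁ * (2 * b * (x₃ - x₁ ^ 2) - 5 / 3)) ^ 2 +
      (2 * b * (x₃ - x₁ ^ 2)) ^ 2 / 4 := by positivity
  linear_combination gap
end

section
/- For all x₁, x₂ ∈ ℝ with x₁² + x₂² ≤ 4, the inequality x₁² + x₂² − x₁²x₂² ≥ (1/8)·(x₁ + x₂)²·(2 − x₁x₂)² holds. Consequently, for f(x₁,x₂) = ½x₁² + ½x₂² − ¼x₁²x₂² and X = {x ∈ ℝ² : x₁ = x₂} (so P_X(x) = ((x₁+x₂)/2, (x₁+x₂)/2)), the gradient ∇f(x) = (x₁ − ½x₁x₂², x₂ − ½x₁²x₂) satisfies ⟨x, ∇f(x)⟩ ≥ ‖P_X ∇f(x)‖² for all x with ‖x‖ ≤ 2; that is, ∇f is (0, P_X)-semimonotone at ((0,0), 0) on the set {x ∈ ℝ² : ‖x‖ ≤ 2} × ℝ². -/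
/-- The inequality in terms of `s = x₁ ^ 2 + x₂ ^ 2` and `p = x₁ * x₂`; it is affine in `s`, so it
suffices to check it at `s = 4` and `s = 2 * |p|`. -/
lemma mul_sq_le_sub_sq_of_abs_le {s p : ℝ} (hs : s ≤ 4) (hp : 2 * p ≤ s) (hn : -(2 * p) ≤ s) :
    (1 / 8) * (s + 2 * p) * (2 - p) ^ 2 ≤ s - p ^ 2 := by
  have h₁ : 0 ≤ 2 - p := by linarith
  have h₂ : 0 ≤ 2 + p := by linarith
  rcases le_total ((2 - p) ^ 2) 8 with hc | hc
  · rcases le_total 0 p with h | h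
    · have hend : 0 ≤ p * (2 - p) * p := by positivity
      have hmono := mul_nonneg (sub_nonneg.2 hp) (sub_nonneg.2 hc)
      linear_combination hend / 2 + hmono / 8
    · have hend : 0 ≤ -p * (2 + p) := mul_nonneg (neg_nonneg.2 h) h₂
      have hmono := mul_nonneg (sub_nonneg.2 hn) (sub_nonneg.2 hc)
      linear_combination hend + hmono / 8
  · have hend : 0 ≤ (2 - p) * (2 + p) * (2 + p) := by positivity
    have hmono := mul_nonneg (sub_nonneg.2 hs) (sub_nonneg.2 hc)
    linear_combination hend / 4 + hmono / 8

theorem statement19 :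
    (∀ x₁ x₂ : ℝ, x₁ ^ 2 + x₂ ^ 2 ≤ 4 →
      x₁ ^ 2 + x₂ ^ 2 - x₁ ^ 2 * x₂ ^ 2 ≥
        (1 / 8) * (x₁ + x₂) ^ 2 * (2 - x₁ * x₂) ^ 2) ∧
    (∀ x₁ x₂ : ℝ, x₁ ^ 2 + x₂ ^ 2 ≤ 4 →
      x₁ * (x₁ - (1 / 2) * x₁ * x₂ ^ 2) + x₂ * (x₂ - (1 / 2) * x₁ ^ 2 * x₂) ≥
        ((x₁ - (1 / 2) * x₁ * x₂ ^ 2) + (x₂ - (1 / 2) * x₁ ^ 2 * x₂)) ^ 2 / 2) := by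
  have key (x₁ x₂ : ℝ) (h : x₁ ^ 2 + x₂ ^ 2 ≤ 4) :
      (1 / 8) * (x₁ ^ 2 + x₂ ^ 2 + 2 * (x₁ * x₂)) * (2 - x₁ * x₂) ^ 2 ≤
        x₁ ^ 2 + x₂ ^ 2 - (x₁ * x₂) ^ 2 :=
    mul_sq_le_sub_sq_of_abs_le h (by linarith [two_mul_le_add_sq x₁ x₂])
      (by linarith [sq_nonneg (x₁ + x₂), add_sq x₁ x₂])
  constructor <;> intro x₁ x₂ h <;> linear_combination key x₁ x₂ h
end
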